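/- arXiv:0804.2619 — 6 statements merged into one kernel-verified Lean document; each statement's English description precedes it below -/
import Mathlib

section
/- Let X be a complete metric space satisfying the NPC inequality, and let γ₁, γ₂ : [0,1] → X be constant-speed geodesics (i.e. dist(γᵢ(s), γᵢ(t)) = cᵢ·|s−t| for all s,t ∈ [0,1], for some constants cᵢ ≥ 0). Then for every t ∈ [0,1], dist(γ₁(t), γ₂(t)) ≤ (1−t)·dist(γ₁(0), γ₂(0)) + t·dist(γ₁(1), γ₂(1)); that is, the distance between the two geodesics is a convex function of the parameter. -/
/-- A metric space satisfies the NPC inequality if every pair of points has a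
midpoint satisfying the CAT(0) comparison inequality. -/
def NPC (X : Type*) [MetricSpace X] : Prop :=
  ∀ x y : X, ∃ m : X, dist x m = dist x y / 2 ∧ dist y m = dist x y / 2 ∧
    ∀ z : X, dist z m ^ 2 ≤
      (1 / 2) * dist z x ^ 2 + (1 / 2) * dist z y ^ 2 - (1 / 4) * dist x y ^ 2

/-- In an NPC space, every metric midpoint satisfies the comparison inequality. -/
theorem NPC.dist_sq_midpoint_le {X : Type*} [MetricSpace X] (hX : NPC X) {x y p : X}
    (hx : dist x p = dist x y / 2) (hy : dist y p = dist x y / 2) (z : X) :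
    dist z p ^ 2 ≤
      (1 / 2) * dist z x ^ 2 + (1 / 2) * dist z y ^ 2 - (1 / 4) * dist x y ^ 2 := by
  obtain ⟨m, -, -, hm⟩ := hX x y
  have hpm : dist p m = 0 := by
    have h := hm p
    rw [dist_comm p x, dist_comm p y, hx, hy] at h
    have h0 : dist p m ^ 2 ≤ 0 := by linarith
    exact pow_eq_zero_iff two_ne_zero |>.1 (le_antisymm h0 (sq_nonneg _))
  rw [dist_eq_zero.1 hpm]
  exact hm z

/-- In an NPC space, the segment joining the midpoints of two sides of a triangle is at most
half as long as the third side. -/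
theorem NPC.dist_midpoints_le_half {X : Type*} [MetricSpace X] (hX : NPC X) {x y z m n : X}
    (hxm : dist x m = dist x y / 2) (hym : dist y m = dist x y / 2)
    (hxn : dist x n = dist x z / 2) (hzn : dist z n = dist x z / 2) :
    dist m n ≤ dist y z / 2 := by
  have h1 := hX.dist_sq_midpoint_le hxn hzn m
  have h2 := hX.dist_sq_midpoint_le hxm hym z
  rw [dist_comm m x, dist_comm m z, hxm] at h1
  rw [dist_comm z x, dist_comm z y] at h2
  refine (sq_le_sq₀ dist_nonneg (by positivity)).1 ?_
  linarith

/-- In an NPC space, the midpoints of two opposite sides of a quadrilateral are at distance at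
most the mean of the lengths of the other two sides. -/
theorem NPC.dist_midpoints_le {X : Type*} [MetricSpace X] (hX : NPC X) {x y x' y' m m' : X}
    (hx : dist x m = dist x y / 2) (hy : dist y m = dist x y / 2)
    (hx' : dist x' m' = dist x' y' / 2) (hy' : dist y' m' = dist x' y' / 2) :
    dist m m' ≤ (dist x x' + dist y y') / 2 := by
  obtain ⟨n, hn, hn', -⟩ := hX x y'
  have h1 := hX.dist_midpoints_le_half hx hy hn hn'
  rw [dist_comm x y'] at hn hn'
  rw [dist_comm x' y'] at hx' hy'
  have h2 := hX.dist_midpoints_le_half hn' hn hy' hx'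
  linarith [dist_triangle m n m']

/-- The midpoint of the restriction of a constant-speed geodesic to a subinterval. -/
theorem dist_midpoint_of_constant_speed {X : Type*} [MetricSpace X] {γ : ℝ → X} {c : ℝ}
    (h : ∀ s ∈ Set.Icc (0 : ℝ) 1, ∀ t ∈ Set.Icc (0 : ℝ) 1, dist (γ s) (γ t) = c * |s - t|)
    {a b : ℝ} (ha : a ∈ Set.Icc (0 : ℝ) 1) (hb : b ∈ Set.Icc (0 : ℝ) 1) :
    dist (γ a) (γ ((a + b) / 2)) = dist (γ a) (γ b) / 2 ∧
      dist (γ b) (γ ((a + b) / 2)) = dist (γ a) (γ b) / 2 := by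
  have hm : (a + b) / 2 ∈ Set.Icc (0 : ℝ) 1 :=
    ⟨by linarith [ha.1, hb.1], by linarith [ha.2, hb.2]⟩
  have e1 : a - (a + b) / 2 = (a - b) / 2 := by ring
  have e2 : b - (a + b) / 2 = -((a - b) / 2) := by ring
  rw [h a ha _ hm, h b hb _ hm, h a ha b hb, e1, e2, abs_neg, abs_div, abs_two]
  constructor <;> ring

/-- A midpoint-convex function on `[0,1]` that is bounded above lies below its chord. -/
theorem le_chord_of_midpoint_convex {f : ℝ → ℝ} {B : ℝ}
    (hB : ∀ t ∈ Set.Icc (0 : ℝ) 1, f t ≤ B)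
    (hf : ∀ a ∈ Set.Icc (0 : ℝ) 1, ∀ b ∈ Set.Icc (0 : ℝ) 1, f ((a + b) / 2) ≤ (f a + f b) / 2)
    {t : ℝ} (ht : t ∈ Set.Icc (0 : ℝ) 1) : f t ≤ (1 - t) * f 0 + t * f 1 := by
  have h0 : (0 : ℝ) ∈ Set.Icc (0 : ℝ) 1 := ⟨le_rfl, zero_le_one⟩
  have h1 : (1 : ℝ) ∈ Set.Icc (0 : ℝ) 1 := ⟨zero_le_one, le_rfl⟩
  have key : ∀ n : ℕ, ∀ t ∈ Set.Icc (0 : ℝ) 1,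
      f t - ((1 - t) * f 0 + t * f 1) ≤ (B + |f 0| + |f 1|) * (1 / 2) ^ n := by
    intro n
    induction n with
    | zero =>
      rintro t ⟨ht0, ht1⟩
      have := hB t ⟨ht0, ht1⟩
      have e0 : -((1 - t) * f 0) ≤ |f 0| := by
        nlinarith [neg_abs_le (f 0), abs_nonneg (f 0)]
      have e1 : -(t * f 1) ≤ |f 1| := by
        nlinarith [neg_abs_le (f 1), abs_nonneg (f 1)]
      rw [pow_zero]
      linarith
    | succ n ih =>
      rintro t ⟨ht0, ht1⟩
      rw [pow_succ]
      rcases le_total t (1 / 2) with h | h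
      · have hs : 2 * t ∈ Set.Icc (0 : ℝ) 1 := ⟨by linarith, by linarith⟩
        have hmid := hf 0 h0 _ hs
        rw [show (0 + 2 * t) / 2 = t by ring] at hmid
        linarith [ih _ hs]
      · have hs : 2 * t - 1 ∈ Set.Icc (0 : ℝ) 1 := ⟨by linarith, by linarith⟩
        have hmid := hf _ hs 1 h1
        rw [show (2 * t - 1 + 1) / 2 = t by ring] at hmid
        linarith [ih _ hs]
  have hlim : Filter.Tendsto (fun n : ℕ => (B + |f 0| + |f 1|) * (1 / 2 : ℝ) ^ n)
      Filter.atTop (nhds 0) := by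
    simpa using (tendsto_pow_atTop_nhds_zero_of_lt_one (r := (1 / 2 : ℝ)) (by norm_num)
      (by norm_num)).const_mul (B + |f 0| + |f 1|)
  exact sub_nonpos.1 (ge_of_tendsto' hlim fun n => key n t ht)


/-- In a complete NPC space, the distance between two constant-speed geodesics
`γ₁, γ₂ : [0,1] → X` is a convex function of the parameter. -/
theorem npc_dist_between_geodesics_convex
    (X : Type*) [MetricSpace X] [CompleteSpace X] (hX : NPC X)
    (γ₁ γ₂ : ℝ → X) (c₁ c₂ : ℝ) (hc₁ : 0 ≤ c₁) (hc₂ : 0 ≤ c₂)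
    (h₁ : ∀ s ∈ Set.Icc (0 : ℝ) 1, ∀ t ∈ Set.Icc (0 : ℝ) 1,
      dist (γ₁ s) (γ₁ t) = c₁ * |s - t|)
    (h₂ : ∀ s ∈ Set.Icc (0 : ℝ) 1, ∀ t ∈ Set.Icc (0 : ℝ) 1,
      dist (γ₂ s) (γ₂ t) = c₂ * |s - t|)
    (t : ℝ) (ht : t ∈ Set.Icc (0 : ℝ) 1) :
    dist (γ₁ t) (γ₂ t) ≤
      (1 - t) * dist (γ₁ 0) (γ₂ 0) + t * dist (γ₁ 1) (γ₂ 1) := by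
  have h0 : (0 : ℝ) ∈ Set.Icc (0 : ℝ) 1 := ⟨le_rfl, zero_le_one⟩
  refine le_chord_of_midpoint_convex (f := fun s => dist (γ₁ s) (γ₂ s))
    (B := c₁ + dist (γ₁ 0) (γ₂ 0) + c₂) ?_ ?_ ht
  · intro s hs
    have e1 := h₁ s hs 0 h0
    have e2 := h₂ 0 h0 s hs
    rw [sub_zero, abs_of_nonneg hs.1] at e1
    rw [zero_sub, abs_neg, abs_of_nonneg hs.1] at e2
    have := dist_triangle4 (γ₁ s) (γ₁ 0) (γ₂ 0) (γ₂ s)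
    have := mul_le_of_le_one_right hc₁ hs.2
    have := mul_le_of_le_one_right hc₂ hs.2
    linarith
  · intro a ha b hb
    obtain ⟨p, q⟩ := dist_midpoint_of_constant_speed h₁ ha hb
    obtain ⟨p', q'⟩ := dist_midpoint_of_constant_speed h₂ ha hb
    exact hX.dist_midpoints_le p q p' q'
end

section
/- Let X be a complete metric space satisfying the NPC inequality, let p ∈ X and λ ∈ [0,1]. For x, y ∈ X, let z_x, z_y ∈ X be points with dist(p, z_x) = λ·dist(p,x), dist(z_x, x) = (1−λ)·dist(p,x), dist(p, z_y) = λ·dist(p,y), and dist(z_y, y) = (1−λ)·dist(p,y). Then dist(z_x, z_y) ≤ λ·dist(x, y). In other words, the geodesic contraction of X toward p by the factor λ is a λ-Lipschitz map. -/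
/-- Stewart's inequality in an NPC space, up to an error that decays geometrically in `n`. -/
theorem NPC.dist_sq_le_add_error {X : Type*} [MetricSpace X] (hX : NPC X) (w : X) (R : ℝ) (n : ℕ) :
    ∀ (p x z : X) (l : ℝ), 0 ≤ l → l ≤ 1 → dist w p ≤ R → dist w x ≤ R →
      dist p z = l * dist p x → dist z x = (1 - l) * dist p x →
      dist w z ^ 2 ≤ (1 - l) * dist w p ^ 2 + l * dist w x ^ 2 - l * (1 - l) * dist p x ^ 2
        + 6 * R * dist p x * (1 / 2) ^ n := by
  induction n with
  | zero =>
    intro p x z l h0 h1 hp hx hz₁ hz₂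
    have hd : 0 ≤ dist p x := dist_nonneg
    have hd2 : dist p x ≤ 2 * R := by linarith [dist_triangle_left p x w]
    have hR : 0 ≤ R := dist_nonneg.trans hp
    have ha : dist w z ≤ dist w p + dist p x := by
      nlinarith [dist_triangle w p z]
    have hb : dist w z ≤ dist w x + dist p x := by
      nlinarith [dist_triangle_right w z x]
    have key : ∀ a : ℝ, 0 ≤ a → a ≤ R → dist w z ≤ a + dist p x →
        dist w z ^ 2 ≤ a ^ 2 + 4 * R * dist p x := by
      intro a h h' hw
      have := pow_le_pow_left₀ dist_nonneg hw 2
      nlinarith [mul_le_mul_of_nonneg_right h' hd, mul_le_mul_of_nonneg_right hd2 hd]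
    have ka := mul_le_mul_of_nonneg_left (key _ dist_nonneg hp ha) (sub_nonneg.2 h1)
    have kb := mul_le_mul_of_nonneg_left (key _ dist_nonneg hx hb) h0
    have hl : l * (1 - l) * dist p x ^ 2 ≤ 1 * dist p x ^ 2 :=
      mul_le_mul_of_nonneg_right (by nlinarith) (sq_nonneg _)
    nlinarith [mul_le_mul_of_nonneg_right hd2 hd]
  | succ n ih =>
    have half : ∀ (p x z : X) (l : ℝ), 0 ≤ l → l ≤ 1 / 2 → dist w p ≤ R → dist w x ≤ R →
        dist p z = l * dist p x → dist z x = (1 - l) * dist p x →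
        dist w z ^ 2 ≤ (1 - l) * dist w p ^ 2 + l * dist w x ^ 2 - l * (1 - l) * dist p x ^ 2
          + 6 * R * dist p x * (1 / 2) ^ (n + 1) := by
      intro p x z l h0 h1 hp hx hz₁ hz₂
      obtain ⟨m, hm₁, hm₂, hm⟩ := hX p x
      have hd : 0 ≤ dist p x := dist_nonneg
      have hR : 0 ≤ R := dist_nonneg.trans hp
      have hpm : dist p z = 2 * l * dist p m := by rw [hz₁, hm₁]; ring
      have hzm : dist z m = (1 - 2 * l) * dist p m := by
        apply le_antisymm
        · have h := hm z
          rw [dist_comm z p, hz₁, hz₂] at h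
          rw [hm₁]
          refine abs_le_of_sq_le_sq' ?_ (mul_nonneg (by linarith) (by linarith)) |>.2
          linarith
        · have := dist_triangle p z m
          rw [hpm] at this
          linarith
      have hwm := hm w
      have hmR : dist w m ≤ R := by
        refine abs_le_of_sq_le_sq' ?_ hR |>.2
        nlinarith [pow_le_pow_left₀ dist_nonneg hp 2, pow_le_pow_left₀ dist_nonneg hx 2]
      have h := ih p m z (2 * l) (by linarith) (by linarith) hp hmR hpm hzm
      have hmul := mul_le_mul_of_nonneg_left hwm (by linarith : 0 ≤ 2 * l)
      rw [hm₁] at h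
      rw [pow_succ (1 / 2 : ℝ)]
      linarith
    intro p x z l h0 h1 hp hx hz₁ hz₂
    rcases le_total l (1 / 2) with hl | hl
    · exact half p x z l h0 hl hp hx hz₁ hz₂
    · have h := half x p z (1 - l) (by linarith) (by linarith) hx hp
        (by rw [dist_comm x z, dist_comm x p, hz₂])
        (by rw [dist_comm z p, dist_comm x p, hz₁]; ring)
      rw [dist_comm x p] at h
      linarith

/-- Stewart's inequality in an NPC space. -/
theorem NPC.dist_sq_le {X : Type*} [MetricSpace X] (hX : NPC X) (w : X) {p x z : X} {l : ℝ}
    (h0 : 0 ≤ l) (h1 : l ≤ 1) (hz₁ : dist p z = l * dist p x)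
    (hz₂ : dist z x = (1 - l) * dist p x) :
    dist w z ^ 2 ≤ (1 - l) * dist w p ^ 2 + l * dist w x ^ 2 - l * (1 - l) * dist p x ^ 2 := by
  set R := max (dist w p) (dist w x)
  have hlim : Filter.Tendsto (fun n : ℕ ↦
      (1 - l) * dist w p ^ 2 + l * dist w x ^ 2 - l * (1 - l) * dist p x ^ 2
        + 6 * R * dist p x * (1 / 2 : ℝ) ^ n) Filter.atTop
      (nhds ((1 - l) * dist w p ^ 2 + l * dist w x ^ 2 - l * (1 - l) * dist p x ^ 2
        + 6 * R * dist p x * 0)) :=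
    ((tendsto_pow_atTop_nhds_zero_of_lt_one (by norm_num) (by norm_num)).const_mul _).const_add _
  rw [mul_zero, add_zero] at hlim
  exact ge_of_tendsto' hlim fun n ↦
    hX.dist_sq_le_add_error w R n p x z l h0 h1 (le_max_left _ _) (le_max_right _ _) hz₁ hz₂

/-- In a complete NPC space, geodesic contraction toward a point `p` by a factor
`l ∈ [0,1]` is `l`-Lipschitz. -/
theorem npc_geodesic_contraction_lipschitz
    (X : Type*) [MetricSpace X] [CompleteSpace X] (hX : NPC X)
    (p : X) (l : ℝ) (hl : l ∈ Set.Icc (0 : ℝ) 1)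
    (x y zx zy : X)
    (hzx₁ : dist p zx = l * dist p x) (hzx₂ : dist zx x = (1 - l) * dist p x)
    (hzy₁ : dist p zy = l * dist p y) (hzy₂ : dist zy y = (1 - l) * dist p y) :
    dist zx zy ≤ l * dist x y := by
  obtain ⟨h0, h1⟩ := hl
  have hy := hX.dist_sq_le zx h0 h1 hzy₁ hzy₂
  have hx := mul_le_mul_of_nonneg_left (hX.dist_sq_le y h0 h1 hzx₁ hzx₂) h0
  rw [dist_comm zx p, hzx₁, dist_comm zx y] at hy
  rw [dist_comm y p, dist_comm y x] at hx
  refine abs_le_of_sq_le_sq' ?_ (mul_nonneg h0 dist_nonneg) |>.2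
  linarith
end

section
/- Let X be a metric space, μ a Borel measure on X, and S ⊆ X a Borel set. Suppose that for every p ∈ X the function r ↦ μ(S ∩ B(p,r))/r² is nondecreasing on (0,∞), where B(p,r) is the open ball of radius r about p. Then there exists Ā ∈ [0,∞] such that for every p ∈ X the quantity μ(S ∩ B(p,r))/r² converges to Ā as r → ∞ (in particular the limit is independent of the basepoint p), and moreover μ(S ∩ B(p,r)) ≤ Ā·r² for every p ∈ X and every r > 0. -/
open MeasureTheory Filter
open scoped ENNReal

/-- A function that is monotone on `(0, ∞)` converges at infinity to an upper bound of its
values on `(0, ∞)`. -/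
theorem exists_tendsto_atTop_of_monotoneOn_pos {f : ℝ → ℝ≥0∞}
    (hf : MonotoneOn f (Set.Ioi 0)) :
    ∃ A : ℝ≥0∞, Tendsto f atTop (nhds A) ∧ ∀ r, 0 < r → f r ≤ A := by
  have hg : Monotone fun r => f (max r 1) := fun r s hrs =>
    hf (Set.mem_Ioi.2 (lt_max_of_lt_right one_pos)) (Set.mem_Ioi.2 (lt_max_of_lt_right one_pos))
      (max_le_max_right 1 hrs)
  have hlim : Tendsto f atTop (nhds (⨆ r, f (max r 1))) := by
    refine (tendsto_atTop_iSup hg).congr' ?_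
    filter_upwards [eventually_ge_atTop 1] with r hr
    rw [max_eq_left hr]
  refine ⟨_, hlim, fun r hr => ge_of_tendsto hlim ?_⟩
  filter_upwards [eventually_ge_atTop r] with s hs
  exact hf hr (hr.trans_le hs) hs

/-- A quadratic bound on the measure of balls about `q` bounds the limiting density ratio
about any other point `p`. -/
theorem density_limit_le_of_measure_ball_le {X : Type*} [MetricSpace X] [MeasurableSpace X]
    {μ : Measure X} {S : Set X} {p q : X} {A B : ℝ≥0∞}
    (hp : Tendsto (fun r : ℝ => μ (S ∩ Metric.ball p r) / ENNReal.ofReal (r ^ 2))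
      atTop (nhds A))
    (hq : ∀ r : ℝ, 0 < r → μ (S ∩ Metric.ball q r) ≤ B * ENNReal.ofReal (r ^ 2)) :
    A ≤ B := by
  have hratio : Tendsto (fun r : ℝ => ((r + dist p q) / r) ^ 2) atTop (nhds 1) := by
    have h : Tendsto (fun r : ℝ => (1 + dist p q / r) ^ 2) atTop (nhds ((1 + 0) ^ 2)) :=
      ((tendsto_const_nhds.div_atTop tendsto_id).const_add 1).pow 2
    rw [add_zero, one_pow] at h
    refine h.congr' ?_
    filter_upwards [eventually_gt_atTop 0] with r hr
    rw [add_div, div_self hr.ne']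
  have hbound : Tendsto (fun r : ℝ => B * ENNReal.ofReal (((r + dist p q) / r) ^ 2))
      atTop (nhds B) := by
    simpa using ENNReal.Tendsto.const_mul (a := B) (ENNReal.tendsto_ofReal hratio)
      (Or.inl (by simp))
  refine le_of_tendsto_of_tendsto hp hbound ?_
  filter_upwards [eventually_gt_atTop 0] with r hr
  have hball : Metric.ball p r ⊆ Metric.ball q (r + dist p q) :=
    Metric.ball_subset_ball' le_rfl
  rw [div_pow, ENNReal.ofReal_div_of_pos (by positivity), ← mul_div_assoc]
  exact ENNReal.div_le_div_right
    ((measure_mono (Set.inter_subset_inter_right S hball)).trans (hq _ (by positivity))) _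

/-- If for every basepoint `p` the density ratio `μ(S ∩ B(p,r)) / r²` is nondecreasing
in `r`, then there is a single `Ā ∈ [0,∞]` such that the ratio converges to `Ā` as
`r → ∞` for every basepoint, and `μ(S ∩ B(p,r)) ≤ Ā · r²` for all `p` and `r > 0`. -/
theorem density_limit_exists
    (X : Type*) [MetricSpace X] [MeasurableSpace X] [BorelSpace X]
    (μ : Measure X) (S : Set X) (hS : MeasurableSet S)
    (hmono : ∀ p : X, ∀ r s : ℝ, 0 < r → r ≤ s →
      μ (S ∩ Metric.ball p r) / ENNReal.ofReal (r ^ 2) ≤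
        μ (S ∩ Metric.ball p s) / ENNReal.ofReal (s ^ 2)) :
    ∃ A : ℝ≥0∞,
      (∀ p : X, Tendsto (fun r : ℝ => μ (S ∩ Metric.ball p r) / ENNReal.ofReal (r ^ 2))
        atTop (nhds A)) ∧
      ∀ p : X, ∀ r : ℝ, 0 < r → μ (S ∩ Metric.ball p r) ≤ A * ENNReal.ofReal (r ^ 2) := by
  have hlim (p : X) := exists_tendsto_atTop_of_monotoneOn_pos
    (f := fun r : ℝ => μ (S ∩ Metric.ball p r) / ENNReal.ofReal (r ^ 2))
    fun r hr s _ hrs => hmono p r s hr hrs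
  choose A hA hle using hlim
  have hmeas (p : X) (r : ℝ) (hr : 0 < r) :
      μ (S ∩ Metric.ball p r) ≤ A p * ENNReal.ofReal (r ^ 2) :=
    (ENNReal.div_le_iff (by simpa using hr.ne') ENNReal.ofReal_ne_top).1 (hle p r hr)
  rcases isEmpty_or_nonempty X with hX | ⟨⟨o⟩⟩
  · exact ⟨0, fun p => hX.elim p, fun p => hX.elim p⟩
  · have heq (p : X) : A p = A o :=
      (density_limit_le_of_measure_ball_le (hA p) (hmeas o)).antisymm
        (density_limit_le_of_measure_ball_le (hA o) (hmeas p))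
    exact ⟨A o, fun p => heq p ▸ hA p, fun p => heq p ▸ hmeas p⟩
end

section
/- Let X be a complete metric space satisfying the NPC inequality, let L ≥ 1, A ≥ 0, and let f : ℝ² → X be an (L,A)-quasi-isometric embedding. Then there exist constants C, A′, D, depending only on L and A, and a map g : ℝ² → X such that g is C-Lipschitz, g is an (L, A′)-quasi-isometric embedding, and dist(f(u), g(u)) ≤ D for every u ∈ ℝ². In particular, every quasiflat in X lies at uniformly bounded Hausdorff distance from the image of a Lipschitz quasi-isometric embedding of ℝ². -/
/-- `f` is an `(L,A)`-quasi-isometric embedding. -/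
def IsQIEmbedding {Y X : Type*} [MetricSpace Y] [MetricSpace X]
    (L A : ℝ) (f : Y → X) : Prop :=
  ∀ u v : Y, (1 / L) * dist u v - A ≤ dist (f u) (f v) ∧
    dist (f u) (f v) ≤ L * dist u v + A

open Filter Topology in
/-- A nonnegative continuous uniformly midpoint-convex function on a complete space attains its
minimum, with quadratic growth away from the minimizer. -/
theorem exists_minimizer_of_uniformly_midpoint_convex {X : Type*} [MetricSpace X] [CompleteSpace X]
    [Nonempty X] (F : X → ℝ) (hF : Continuous F) (hF0 : ∀ z, 0 ≤ F z)
    (hmid : ∀ x y, ∃ m, F m ≤ (1 / 2) * F x + (1 / 2) * F y - (1 / 4) * dist x y ^ 2) :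
    ∃ b, ∀ z, F b + (1 / 2) * dist b z ^ 2 ≤ F z := by
  have hbdd : BddBelow (Set.range F) := ⟨0, by rintro _ ⟨z, rfl⟩; exact hF0 z⟩
  have hI : ∀ z, (⨅ z, F z) ≤ F z := fun z => ciInf_le hbdd z
  have hseq : ∀ n : ℕ, ∃ x, F x < (⨅ z, F z) + 1 / ((n : ℝ) + 1) := fun n =>
    exists_lt_of_ciInf_lt (lt_add_of_pos_right _ Nat.one_div_pos_of_nat)
  choose x hx using hseq
  have hlim : Tendsto (fun n : ℕ => 1 / ((n : ℝ) + 1)) atTop (𝓝 0) :=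
    tendsto_one_div_add_atTop_nhds_zero_nat
  have hcauchy : CauchySeq x := by
    refine cauchySeq_of_le_tendsto_0' (fun n : ℕ => √(4 * (1 / ((n : ℝ) + 1)))) ?_ ?_
    · intro n m hnm
      refine Real.le_sqrt_of_sq_le ?_
      obtain ⟨p, hp⟩ := hmid (x n) (x m)
      have h1 := hI p
      have h2 := hx n
      have h3 := hx m
      have h4 : 1 / ((m : ℝ) + 1) ≤ 1 / ((n : ℝ) + 1) := Nat.one_div_le_one_div hnm
      linarith
    · simpa using (hlim.const_mul 4).sqrt
  obtain ⟨b, hb⟩ := cauchySeq_tendsto_of_complete hcauchy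
  have hFb : F b ≤ ⨅ z, F z := by
    refine le_of_tendsto_of_tendsto' ((hF.tendsto b).comp hb) ?_ fun n => (hx n).le
    simpa using hlim.const_add (⨅ z, F z)
  refine ⟨b, fun z => ?_⟩
  obtain ⟨p, hp⟩ := hmid b z
  linarith [hI p]

/-- Weighted barycenters of finite families in a complete NPC space, with the variance
inequality. -/
theorem NPC.exists_barycenter {X ι : Type*} [MetricSpace X] [CompleteSpace X] [Nonempty X]
    (hX : NPC X) (T : Finset ι) (w : ι → ℝ) (p : ι → X) (hw : ∀ i, 0 ≤ w i)
    (hW : 1 ≤ ∑ i ∈ T, w i) :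
    ∃ b, ∀ z, ∑ i ∈ T, w i * dist b (p i) ^ 2 + (1 / 2) * dist b z ^ 2 ≤
      ∑ i ∈ T, w i * dist z (p i) ^ 2 := by
  refine exists_minimizer_of_uniformly_midpoint_convex
    (fun z => ∑ i ∈ T, w i * dist z (p i) ^ 2) (by fun_prop)
    (fun z => Finset.sum_nonneg fun i _ => mul_nonneg (hw i) (sq_nonneg _)) fun x y => ?_
  obtain ⟨m, -, -, hm⟩ := hX x y
  refine ⟨m, ?_⟩
  have h : ∑ i ∈ T, w i * dist m (p i) ^ 2 ≤ ∑ i ∈ T, w i *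
      ((1 / 2) * dist x (p i) ^ 2 + (1 / 2) * dist y (p i) ^ 2 - (1 / 4) * dist x y ^ 2) := by
    refine Finset.sum_le_sum fun i _ => mul_le_mul_of_nonneg_left ?_ (hw i)
    simpa only [dist_comm (p i)] using hm (p i)
  have h' : ∑ i ∈ T, w i *
      ((1 / 2) * dist x (p i) ^ 2 + (1 / 2) * dist y (p i) ^ 2 - (1 / 4) * dist x y ^ 2) =
      (1 / 2) * ∑ i ∈ T, w i * dist x (p i) ^ 2 + (1 / 2) * ∑ i ∈ T, w i * dist y (p i) ^ 2 -
        (1 / 4) * dist x y ^ 2 * ∑ i ∈ T, w i := by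
    simp only [Finset.mul_sum, ← Finset.sum_add_distrib, ← Finset.sum_sub_distrib]
    exact Finset.sum_congr rfl fun i _ => by ring
  have := mul_le_mul_of_nonneg_left hW (by positivity : 0 ≤ (1 / 4) * dist x y ^ 2)
  linarith

/-- Points satisfying the variance inequality for two weightings of one family depend on the
weights in a Lipschitz way. -/
theorem dist_barycenter_le {X ι : Type*} [MetricSpace X] (T : Finset ι) (w w' : ι → ℝ) (p : ι → X)
    {b b' : X} {M δ : ℝ}
    (hb : ∀ z, ∑ i ∈ T, w i * dist b (p i) ^ 2 + (1 / 2) * dist b z ^ 2 ≤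
      ∑ i ∈ T, w i * dist z (p i) ^ 2)
    (hb' : ∀ z, ∑ i ∈ T, w' i * dist b' (p i) ^ 2 + (1 / 2) * dist b' z ^ 2 ≤
      ∑ i ∈ T, w' i * dist z (p i) ^ 2)
    (hM : ∀ i ∈ T, dist b (p i) ≤ M) (hM' : ∀ i ∈ T, dist b' (p i) ≤ M)
    (hδ : ∀ i ∈ T, |w i - w' i| ≤ δ) (hδ0 : 0 ≤ δ) (hM0 : 0 ≤ M) :
    dist b b' ≤ T.card * (δ * (2 * M)) := by
  have h1 := hb b'
  have h2 := hb' b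
  rw [dist_comm b' b] at h2
  have h3 : ∑ i ∈ T, (w i - w' i) * (dist b' (p i) ^ 2 - dist b (p i) ^ 2) ≤
      ∑ _i ∈ T, δ * (dist b b' * (2 * M)) := by
    refine Finset.sum_le_sum fun i hi => (le_abs_self _).trans ?_
    rw [abs_mul, sq_sub_sq, abs_mul, mul_comm |_ + _|]
    have h4 : |dist b' (p i) - dist b (p i)| ≤ dist b b' := by
      rw [dist_comm b b']; exact abs_dist_sub_le _ _ _
    have h5 : |dist b' (p i) + dist b (p i)| ≤ 2 * M := by
      rw [abs_of_nonneg (by positivity)]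
      linarith [hM i hi, hM' i hi]
    gcongr
    exact hδ i hi
  have h4 : ∑ i ∈ T, (w i - w' i) * (dist b' (p i) ^ 2 - dist b (p i) ^ 2) =
      (∑ i ∈ T, w i * dist b' (p i) ^ 2 - ∑ i ∈ T, w i * dist b (p i) ^ 2) +
      (∑ i ∈ T, w' i * dist b (p i) ^ 2 - ∑ i ∈ T, w' i * dist b' (p i) ^ 2) := by
    simp only [← Finset.sum_add_distrib, ← Finset.sum_sub_distrib]
    exact Finset.sum_congr rfl fun i _ => by ring
  rw [Finset.sum_const, nsmul_eq_mul] at h3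
  have h5 : dist b b' * dist b b' ≤ (T.card * (δ * (2 * M))) * dist b b' := by nlinarith
  rcases (dist_nonneg (x := b) (y := b')).eq_or_lt with h | h
  · rw [← h]; positivity
  · exact le_of_mul_le_mul_right h5 h

/-- The point of the integer lattice in the plane with given coordinates. -/
noncomputable def latticePoint (i : ℤ × ℤ) : EuclideanSpace ℝ (Fin 2) := !₂[(i.1 : ℝ), (i.2 : ℝ)]

/-- The tent function of radius `2` centred at a lattice point. -/
noncomputable def latticeTent (x : EuclideanSpace ℝ (Fin 2)) (i : ℤ × ℤ) : ℝ :=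
  max 0 (2 - dist x (latticePoint i))

/-- A finite block of lattice indices around a point of the plane. -/
noncomputable def latticeBlock (x : EuclideanSpace ℝ (Fin 2)) : Finset (ℤ × ℤ) :=
  Finset.Icc (⌊x 0⌋ - 4) (⌊x 0⌋ + 4) ×ˢ Finset.Icc (⌊x 1⌋ - 4) (⌊x 1⌋ + 4)

theorem latticeTent_nonneg (x : EuclideanSpace ℝ (Fin 2)) (i : ℤ × ℤ) : 0 ≤ latticeTent x i :=
  le_max_left _ _

theorem latticeTent_le_two (x : EuclideanSpace ℝ (Fin 2)) (i : ℤ × ℤ) : latticeTent x i ≤ 2 :=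
  max_le zero_le_two (sub_le_self _ dist_nonneg)

theorem abs_latticeTent_sub_le (x y : EuclideanSpace ℝ (Fin 2)) (i : ℤ × ℤ) :
    |latticeTent x i - latticeTent y i| ≤ dist x y := by
  simp only [latticeTent, max_comm (0 : ℝ)]
  refine (abs_max_sub_max_le_abs _ _ _).trans ?_
  rw [sub_sub_sub_cancel_left, dist_comm x y]
  exact abs_dist_sub_le _ _ _

theorem latticeTent_eq_zero {x : EuclideanSpace ℝ (Fin 2)} {i : ℤ × ℤ}
    (h : 2 ≤ dist x (latticePoint i)) : latticeTent x i = 0 :=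
  max_eq_left (by linarith)

theorem card_latticeBlock (x : EuclideanSpace ℝ (Fin 2)) : (latticeBlock x).card = 81 := by
  simp only [latticeBlock, Finset.card_product, Int.card_Icc]
  have h (a : ℤ) : (a + 4 + 1 - (a - 4)).toNat = 9 := by omega
  rw [h, h]

theorem abs_coord_sub_latticePoint_le (x : EuclideanSpace ℝ (Fin 2)) (i : ℤ × ℤ) :
    |x 0 - i.1| ≤ dist x (latticePoint i) ∧ |x 1 - i.2| ≤ dist x (latticePoint i) := by
  rw [EuclideanSpace.dist_eq, Fin.sum_univ_two]
  constructor <;> refine Real.le_sqrt_of_sq_le ?_ <;>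
    simp [latticePoint, Real.dist_eq, sq_nonneg]

theorem dist_latticePoint_le {x : EuclideanSpace ℝ (Fin 2)} {i : ℤ × ℤ} {r s : ℝ}
    (hr : |x 0 - i.1| ≤ r) (hs : |x 1 - i.2| ≤ s) : dist x (latticePoint i) ≤ √(r ^ 2 + s ^ 2) := by
  rw [EuclideanSpace.dist_eq, Fin.sum_univ_two]
  simp only [latticePoint, Real.dist_eq]
  refine Real.sqrt_le_sqrt ?_
  gcongr <;> simpa

theorem mem_latticeBlock {x : EuclideanSpace ℝ (Fin 2)} {i : ℤ × ℤ}
    (h : dist x (latticePoint i) < 4) : i ∈ latticeBlock x := by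
  obtain ⟨h0, h1⟩ := abs_coord_sub_latticePoint_le x i
  have key (a : ℝ) (n : ℤ) (ha : |a - n| < 4) : ⌊a⌋ - 4 ≤ n ∧ n ≤ ⌊a⌋ + 4 := by
    rw [abs_lt] at ha
    constructor
    · have : ((⌊a⌋ - 4 : ℤ) : ℝ) ≤ n := by push_cast; linarith [Int.floor_le a]
      exact_mod_cast this
    · have : (n : ℝ) < ((⌊a⌋ + 4 + 1 : ℤ) : ℝ) := by push_cast; linarith [Int.lt_floor_add_one a]
      exact Int.lt_add_one_iff.mp (by exact_mod_cast this)
  simp only [latticeBlock, Finset.mem_product, Finset.mem_Icc]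
  exact ⟨key _ _ (h0.trans_lt h), key _ _ (h1.trans_lt h)⟩

theorem dist_le_of_mem_latticeBlock {x : EuclideanSpace ℝ (Fin 2)} {i : ℤ × ℤ}
    (h : i ∈ latticeBlock x) : dist x (latticePoint i) ≤ 10 := by
  simp only [latticeBlock, Finset.mem_product, Finset.mem_Icc] at h
  have key (a : ℝ) (n : ℤ) (ha : ⌊a⌋ - 4 ≤ n ∧ n ≤ ⌊a⌋ + 4) : |a - n| ≤ 5 := by
    have h1 : ((⌊a⌋ - 4 : ℤ) : ℝ) ≤ n := by exact_mod_cast ha.1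
    have h2 : (n : ℝ) ≤ ((⌊a⌋ + 4 : ℤ) : ℝ) := by exact_mod_cast ha.2
    push_cast at h1 h2
    rw [abs_le]
    constructor <;> linarith [Int.floor_le a, Int.lt_floor_add_one a]
  refine (dist_latticePoint_le (key _ _ h.1) (key _ _ h.2)).trans ?_
  rw [Real.sqrt_le_left (by norm_num)]
  norm_num

theorem exists_dist_latticePoint_le_one (x : EuclideanSpace ℝ (Fin 2)) :
    ∃ i, dist x (latticePoint i) ≤ 1 := by
  refine ⟨(round (x 0), round (x 1)),
    (dist_latticePoint_le (abs_sub_round (x 0)) (abs_sub_round (x 1))).trans ?_⟩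
  rw [Real.sqrt_le_left (by norm_num)]
  norm_num

theorem one_le_sum_latticeTent (x : EuclideanSpace ℝ (Fin 2)) :
    1 ≤ ∑ i ∈ latticeBlock x, latticeTent x i := by
  obtain ⟨i, hi⟩ := exists_dist_latticePoint_le_one x
  calc 1 ≤ latticeTent x i := le_max_of_le_right (by linarith)
    _ ≤ _ := Finset.single_le_sum (fun j _ => latticeTent_nonneg x j)
      (mem_latticeBlock (by linarith))

/-- Tent-weighted sums may be computed over the block of any nearby point. -/
theorem sum_latticeBlock_eq_of_dist_le_one {x y : EuclideanSpace ℝ (Fin 2)} (h : dist x y ≤ 1)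
    (φ : ℤ × ℤ → ℝ) : ∑ i ∈ latticeBlock x, latticeTent y i * φ i =
      ∑ i ∈ latticeBlock y, latticeTent y i * φ i := by
  have key (z : EuclideanSpace ℝ (Fin 2)) (hz : dist z y ≤ 1) (i : ℤ × ℤ)
      (hi : i ∉ latticeBlock z) : latticeTent y i * φ i = 0 := by
    rw [latticeTent_eq_zero, zero_mul]
    by_contra! hlt
    exact hi (mem_latticeBlock (by linarith [dist_triangle z y (latticePoint i)]))
  rw [Finset.sum_subset Finset.subset_union_left fun i _ => key x h i,
    ← Finset.sum_subset Finset.subset_union_right fun i _ => key y (by simp) i]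

/-- Every `(L,A)`-quasi-isometric embedding of `ℝ²` into a complete NPC space is at
uniformly bounded distance (depending only on `L` and `A`) from a `C`-Lipschitz
`(L,A′)`-quasi-isometric embedding. -/
theorem quasiflat_lipschitz_approximation :
    ∀ L A : ℝ, 1 ≤ L → 0 ≤ A →
      ∃ C A' D : ℝ,
        ∀ (X : Type*) [MetricSpace X] [CompleteSpace X], NPC X →
          ∀ f : EuclideanSpace ℝ (Fin 2) → X, IsQIEmbedding L A f →
            ∃ g : EuclideanSpace ℝ (Fin 2) → X,
              (∀ u v : EuclideanSpace ℝ (Fin 2), dist (g u) (g v) ≤ C * dist u v) ∧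
              IsQIEmbedding L A' g ∧
              ∀ u : EuclideanSpace ℝ (Fin 2), dist (f u) (g u) ≤ D := by
  intro L A hL hA
  obtain ⟨D, hD⟩ : ∃ D, D = 18 * (10 * L + A) := ⟨_, rfl⟩
  obtain ⟨M, hMdef⟩ : ∃ M, M = D + (11 * L + A) := ⟨_, rfl⟩
  have hD0 : 0 ≤ D := by rw [hD]; positivity
  have hM0 : 0 ≤ M := by rw [hMdef]; positivity
  refine ⟨81 * (2 * M) + (L + A + 2 * D), A + 2 * D, D, ?_⟩
  intro X _ _ hX f hf
  have : Nonempty X := ⟨f 0⟩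
  choose g hg using fun x => hX.exists_barycenter (latticeBlock x) (latticeTent x)
    (fun i => f (latticePoint i)) (latticeTent_nonneg x) (one_le_sum_latticeTent x)
  have hfdist {x y : EuclideanSpace ℝ (Fin 2)} {r : ℝ} (h : dist x y ≤ r) :
      dist (f x) (f y) ≤ L * r + A := (hf x y).2.trans (by gcongr)
  have hfg (x : EuclideanSpace ℝ (Fin 2)) : dist (f x) (g x) ≤ D := by
    have h1 := hg x (f x)
    have h2 : 0 ≤ ∑ i ∈ latticeBlock x, latticeTent x i * dist (g x) (f (latticePoint i)) ^ 2 :=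
      Finset.sum_nonneg fun i _ => mul_nonneg (latticeTent_nonneg x i) (sq_nonneg _)
    have h3 : ∑ i ∈ latticeBlock x, latticeTent x i * dist (f x) (f (latticePoint i)) ^ 2 ≤
        ∑ _i ∈ latticeBlock x, 2 * (10 * L + A) ^ 2 := by
      refine Finset.sum_le_sum fun i hi => ?_
      have h4 := hfdist (dist_le_of_mem_latticeBlock hi)
      have h5 := latticeTent_le_two x i
      gcongr
      linarith
    rw [Finset.sum_const, card_latticeBlock, nsmul_eq_mul] at h3
    push_cast at h3
    rw [dist_comm]
    refine abs_le_of_sq_le_sq' ?_ hD0 |>.2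
    rw [hD]
    linarith
  have hgf (x : EuclideanSpace ℝ (Fin 2)) : dist (g x) (f x) ≤ D := dist_comm (f x) _ ▸ hfg x
  have hupper (u v : EuclideanSpace ℝ (Fin 2)) : dist (g u) (g v) ≤ L * dist u v + (A + 2 * D) := by
    linarith [dist_triangle4 (g u) (f u) (f v) (g v), (hf u v).2, hfg v, hgf u]
  refine ⟨g, fun u v => ?_, fun u v => ⟨?_, hupper u v⟩, hfg⟩
  · rcases le_total (dist u v) 1 with h | h
    · have hM (i) (hi : i ∈ latticeBlock u) : dist (g u) (f (latticePoint i)) ≤ M := by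
        linarith [dist_triangle (g u) (f u) (f (latticePoint i)), hgf u,
          hfdist (dist_le_of_mem_latticeBlock hi)]
      have hM' (i) (hi : i ∈ latticeBlock u) : dist (g v) (f (latticePoint i)) ≤ M := by
        have h1 : dist v (latticePoint i) ≤ 11 := by
          linarith [dist_triangle v u (latticePoint i), dist_comm u v,
            dist_le_of_mem_latticeBlock hi]
        linarith [dist_triangle (g v) (f v) (f (latticePoint i)), hgf v, hfdist h1]
      have hv := hg v
      simp only [← sum_latticeBlock_eq_of_dist_le_one h] at hv
      have key := dist_barycenter_le (latticeBlock u) _ _ _ (hg u) hv hM hM'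
        (fun i _ => abs_latticeTent_sub_le u v i) dist_nonneg hM0
      rw [card_latticeBlock] at key
      push_cast at key
      have : 0 ≤ (L + A + 2 * D) * dist u v := by positivity
      linarith
    · have h1 : 0 ≤ 81 * (2 * M) * dist u v := by positivity
      have h2 : 0 ≤ (A + 2 * D) * (dist u v - 1) := mul_nonneg (by positivity) (by linarith)
      linarith [hupper u v]
  · linarith [dist_triangle4 (f u) (g u) (g v) (f v), (hf u v).1, hfg u, hgf v]
end

section
/- Let Y and X be complete metric spaces, each satisfying the NPC inequality, and let ψ : Y → X be a locally isometric map, meaning that for every y ∈ Y there exists ε > 0 such that dist(ψ(a), ψ(b)) = dist(a,b) for all a, b in the open ball B(y, ε). Then ψ is an isometric embedding: dist(ψ(a), ψ(b)) = dist(a,b) for all a, b ∈ Y. -/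
open Filter Topology

/-- In an NPC space every metric midpoint satisfies the comparison inequality. -/
theorem NPC.sq_dist_le {X : Type*} [MetricSpace X] (hX : NPC X) {x y m : X}
    (hx : dist x m = dist x y / 2) (hy : dist y m = dist x y / 2) (z : X) :
    dist z m ^ 2 ≤
      (1 / 2) * dist z x ^ 2 + (1 / 2) * dist z y ^ 2 - (1 / 4) * dist x y ^ 2 := by
  obtain ⟨m', -, -, h⟩ := hX x y
  have h0 := h m
  rw [dist_comm m x, dist_comm m y, hx, hy] at h0
  have hmm : dist m m' = 0 := by
    have : dist m m' ^ 2 ≤ 0 := by nlinarith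
    exact pow_eq_zero_iff two_ne_zero |>.1 (le_antisymm this (sq_nonneg _))
  rw [dist_eq_zero.1 hmm]
  exact h z

/-- In an NPC space, a chain of points that is straight at each interior vertex, with equal
steps, is straight. -/
theorem NPC.mul_le_dist_of_locally_straight {X : Type*} [MetricSpace X] (hX : NPC X)
    {x : ℕ → X} {δ : ℝ} {n : ℕ} (hn : 2 ≤ n)
    (h₁ : ∀ i, i + 1 ≤ n → dist (x i) (x (i + 1)) = δ)
    (h₂ : ∀ i, i + 2 ≤ n → dist (x i) (x (i + 2)) = 2 * δ) :
    n * δ ≤ dist (x 0) (x n) := by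
  have key : ∀ i, i + 1 ≤ n →
      dist (x 0) (x i) ^ 2 + (2 * i + 1) * δ ^ 2 ≤ dist (x 0) (x (i + 1)) ^ 2 ∧
      ((i + 1 : ℕ) * δ) ^ 2 ≤ dist (x 0) (x (i + 1)) ^ 2 := by
    intro i
    induction i with
    | zero =>
      intro h
      have := h₁ 0 h
      simp only [zero_add] at this
      simp [this]
    | succ i ih =>
      intro h
      obtain ⟨ih₁, ih₂⟩ := ih (by omega)
      have h2 := h₂ i h
      have hm := hX.sq_dist_le (x := x i) (y := x (i + 2)) (m := x (i + 1))
        (by rw [h₁ i (by omega), h2]; ring)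
        (by rw [dist_comm, h₁ (i + 1) h, h2]; ring) (x 0)
      rw [h2] at hm
      push_cast at ih₁ ih₂ ⊢
      rw [show i + 1 + 1 = i + 2 from rfl]
      constructor <;> nlinarith
  obtain ⟨k, rfl⟩ : ∃ k, n = k + 1 := ⟨n - 1, by omega⟩
  exact (abs_le_of_sq_le_sq' (key k le_rfl).2 dist_nonneg).2

/-- The `2 ^ k`-fold subdivision of a pair of points by iterated midpoints. -/
def dyadicChain {Y : Type*} (mid : Y → Y → Y) (a b : Y) : ℕ → ℕ → Y
  | 0, i => if i = 0 then a else b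
  | k + 1, i =>
    if i % 2 = 0 then dyadicChain mid a b k (i / 2)
    else mid (dyadicChain mid a b k (i / 2)) (dyadicChain mid a b k (i / 2 + 1))

section dyadicChain

variable {Y : Type*} {mid : Y → Y → Y} {a b : Y}

theorem dyadicChain_succ_two_mul (k i : ℕ) :
    dyadicChain mid a b (k + 1) (2 * i) = dyadicChain mid a b k i := by
  simp [dyadicChain]

theorem dyadicChain_succ_two_mul_add_one (k i : ℕ) :
    dyadicChain mid a b (k + 1) (2 * i + 1) =
      mid (dyadicChain mid a b k i) (dyadicChain mid a b k (i + 1)) := by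
  have h : (2 * i + 1) / 2 = i := by omega
  have h' : (2 * i + 1) % 2 = 1 := by omega
  simp [dyadicChain, h, h']

theorem dyadicChain_add (k l i : ℕ) :
    dyadicChain mid a b (k + l) (2 ^ l * i) = dyadicChain mid a b k i := by
  induction l with
  | zero => simp
  | succ l ih =>
    rw [← add_assoc, pow_succ', mul_assoc, dyadicChain_succ_two_mul, ih]

theorem dyadicChain_zero_right (k : ℕ) : dyadicChain mid a b k 0 = a := by
  simpa [dyadicChain] using dyadicChain_add (mid := mid) (a := a) (b := b) 0 k 0

theorem dyadicChain_two_pow (k : ℕ) : dyadicChain mid a b k (2 ^ k) = b := by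
  simpa [dyadicChain] using dyadicChain_add (mid := mid) (a := a) (b := b) 0 k 1

variable [MetricSpace Y]

theorem dist_dyadicChain_succ_le (hl : ∀ x y, dist x (mid x y) = dist x y / 2)
    (hr : ∀ x y, dist y (mid x y) = dist x y / 2) (k i : ℕ) :
    dist (dyadicChain mid a b k i) (dyadicChain mid a b k (i + 1)) ≤ dist a b / 2 ^ k := by
  induction k generalizing i with
  | zero => by_cases h : i = 0 <;> simp [dyadicChain, h]
  | succ k ih =>
    have h2 : dist a b / 2 ^ (k + 1) = dist a b / 2 ^ k / 2 := by rw [pow_succ]; ring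
    rw [h2]
    obtain ⟨j, rfl | rfl⟩ := Nat.even_or_odd' i
    · have := ih j
      rw [dyadicChain_succ_two_mul, dyadicChain_succ_two_mul_add_one, hl]
      linarith
    · have := ih j
      rw [dyadicChain_succ_two_mul_add_one, show 2 * j + 1 + 1 = 2 * (j + 1) by ring,
        dyadicChain_succ_two_mul, dist_comm, hr]
      linarith

theorem dist_dyadicChain_le_of_le (hl : ∀ x y, dist x (mid x y) = dist x y / 2)
    (hr : ∀ x y, dist y (mid x y) = dist x y / 2) (k : ℕ) {i j : ℕ} (hij : i ≤ j) :
    dist (dyadicChain mid a b k i) (dyadicChain mid a b k j) ≤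
      ((j : ℝ) - i) * (dist a b / 2 ^ k) := by
  have := dist_le_Ico_sum_of_dist_le (f := dyadicChain mid a b k) hij
    (d := fun _ => dist a b / 2 ^ k) (fun _ _ => dist_dyadicChain_succ_le hl hr k _)
  simpa [Nat.cast_sub hij] using this

/-- On indices within range, the dyadic chain is equally spaced on a geodesic. -/
theorem dist_dyadicChain_eq (hl : ∀ x y, dist x (mid x y) = dist x y / 2)
    (hr : ∀ x y, dist y (mid x y) = dist x y / 2) (k : ℕ) {i j : ℕ} (hij : i ≤ j)
    (hj : j ≤ 2 ^ k) :
    dist (dyadicChain mid a b k i) (dyadicChain mid a b k j) =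
      ((j : ℝ) - i) * (dist a b / 2 ^ k) := by
  refine le_antisymm (dist_dyadicChain_le_of_le hl hr k hij) ?_
  have h₁ := dist_dyadicChain_le_of_le (a := a) (b := b) hl hr k (Nat.zero_le i)
  have h₂ := dist_dyadicChain_le_of_le (a := a) (b := b) hl hr k hj
  have h₃ := dist_triangle4 (dyadicChain mid a b k 0) (dyadicChain mid a b k i)
    (dyadicChain mid a b k j) (dyadicChain mid a b k (2 ^ k))
  rw [dyadicChain_zero_right, dyadicChain_two_pow] at h₃
  rw [dyadicChain_zero_right] at h₁
  rw [dyadicChain_two_pow] at h₂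
  have h₄ : (2 : ℝ) ^ k * (dist a b / 2 ^ k) = dist a b := by field_simp
  push_cast at h₁ h₂
  linarith

/-- The dyadic chain is Lipschitz in the dyadic rational `i / 2 ^ k`. -/
theorem dist_dyadicChain_le (hl : ∀ x y, dist x (mid x y) = dist x y / 2)
    (hr : ∀ x y, dist y (mid x y) = dist x y / 2) (k l i j : ℕ) :
    dist (dyadicChain mid a b k i) (dyadicChain mid a b l j) ≤
      dist a b * dist ((i : ℝ) / 2 ^ k) ((j : ℝ) / 2 ^ l) := by
  have key : ∀ n p q : ℕ, dist (dyadicChain mid a b n p) (dyadicChain mid a b n q) ≤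
      dist a b * |(p : ℝ) / 2 ^ n - q / 2 ^ n| := by
    intro n p q
    wlog h : p ≤ q generalizing p q
    · rw [dist_comm, abs_sub_comm]
      exact this q p (by omega)
    refine (dist_dyadicChain_le_of_le hl hr n h).trans (le_of_eq ?_)
    have h' : (p : ℝ) ≤ q := by exact_mod_cast h
    rw [abs_sub_comm, ← sub_div, abs_of_nonneg (div_nonneg (sub_nonneg.2 h') (by positivity))]
    ring
  have h := key (k + l) (2 ^ l * i) (2 ^ k * j)
  rw [dyadicChain_add, add_comm k l, dyadicChain_add] at h
  rw [Real.dist_eq]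
  convert h using 4
  · push_cast; rw [pow_add]; field_simp
  · push_cast; rw [pow_add]; field_simp

/-- A map that is isometric near every point is isometric on triples of consecutive points of a
sufficiently fine dyadic chain. -/
theorem exists_dyadicChain_isometric_on_triples [CompleteSpace Y] {X : Type*} [MetricSpace X]
    {ψ : Y → X}
    (hloc : ∀ y : Y, ∃ ε > (0 : ℝ), ∀ u ∈ Metric.ball y ε, ∀ v ∈ Metric.ball y ε,
      dist (ψ u) (ψ v) = dist u v)
    (hl : ∀ x y, dist x (mid x y) = dist x y / 2)
    (hr : ∀ x y, dist y (mid x y) = dist x y / 2) (a b : Y) :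
    ∃ k, 1 ≤ k ∧ ∀ i, i + 2 ≤ 2 ^ k → ∀ s ≤ 2, ∀ t ≤ 2,
      dist (ψ (dyadicChain mid a b k (i + s))) (ψ (dyadicChain mid a b k (i + t))) =
        dist (dyadicChain mid a b k (i + s)) (dyadicChain mid a b k (i + t)) := by
  by_contra! hbad
  choose i hi s hs t ht hne using fun k : ℕ => hbad (k + 1) (by omega)
  have hmem : ∀ k, (i k : ℝ) / 2 ^ (k + 1) ∈ Set.Icc (0 : ℝ) 1 := by
    intro k
    refine ⟨by positivity, (div_le_one (by positivity)).2 ?_⟩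
    exact_mod_cast (by have := hi k; omega : i k ≤ 2 ^ (k + 1))
  obtain ⟨τ, -, φ, hφ, hlim⟩ := isCompact_Icc.tendsto_subseq hmem
  have hcau : CauchySeq fun n => dyadicChain mid a b (φ n + 1) (i (φ n)) := by
    rw [Metric.cauchySeq_iff]
    intro ε hε
    obtain ⟨N, hN⟩ := Metric.cauchySeq_iff.1 hlim.cauchySeq (ε / (dist a b + 1)) (by positivity)
    refine ⟨N, fun m hm n hn => (dist_dyadicChain_le hl hr _ _ _ _).trans_lt ?_⟩
    have h := hN m hm n hn
    rw [lt_div_iff₀ (by positivity)] at h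
    simp only [Function.comp_apply] at h
    nlinarith [dist_nonneg (x := (i (φ m) : ℝ) / 2 ^ (φ m + 1))
      (y := (i (φ n) : ℝ) / 2 ^ (φ n + 1))]
  obtain ⟨y, hy⟩ := cauchySeq_tendsto_of_complete hcau
  obtain ⟨ε, hε, hiso⟩ := hloc y
  have hsmall : Tendsto (fun n => 2 * (dist a b / 2 ^ (φ n + 1))) atTop (𝓝 0) := by
    have h : Tendsto (fun n : ℕ => 2 * (dist a b * (1 / 2 : ℝ) ^ n)) atTop (𝓝 0) := by
      simpa using ((tendsto_pow_atTop_nhds_zero_of_lt_one (r := (1 / 2 : ℝ)) (by norm_num)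
        (by norm_num)).const_mul (dist a b)).const_mul 2
    refine (h.comp ((tendsto_add_atTop_nat 1).comp hφ.tendsto_atTop)).congr fun n => ?_
    simp [div_eq_mul_inv]
  obtain ⟨n, hn₁, hn₂⟩ := ((hsmall.eventually_lt_const (half_pos hε)).and
    (hy.eventually (Metric.ball_mem_nhds y (half_pos hε)))).exists
  have hball : ∀ r ≤ 2, dyadicChain mid a b (φ n + 1) (i (φ n) + r) ∈ Metric.ball y ε := by
    intro r hr2
    have h := dist_dyadicChain_le_of_le (a := a) (b := b) hl hr (φ n + 1)
      (Nat.le_add_right (i (φ n)) r)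
    have hr' : (r : ℝ) ≤ 2 := by exact_mod_cast hr2
    have h' : (((i (φ n) + r : ℕ) : ℝ) - i (φ n)) * (dist a b / 2 ^ (φ n + 1)) ≤
        2 * (dist a b / 2 ^ (φ n + 1)) := by
      push_cast
      gcongr
      linarith
    rw [dist_comm] at h
    rw [Metric.mem_ball]
    linarith [dist_triangle (dyadicChain mid a b (φ n + 1) (i (φ n) + r))
      (dyadicChain mid a b (φ n + 1) (i (φ n))) y]
  exact hne (φ n) (hiso _ (hball _ (hs _)) _ (hball _ (ht _)))

end dyadicChain

/-- A locally isometric map between complete NPC spaces is an isometric embedding. -/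
theorem local_isometry_is_isometric_embedding
    (Y X : Type*) [MetricSpace Y] [MetricSpace X]
    [CompleteSpace Y] [CompleteSpace X] (hY : NPC Y) (hX : NPC X)
    (ψ : Y → X)
    (hloc : ∀ y : Y, ∃ ε > (0 : ℝ), ∀ a ∈ Metric.ball y ε, ∀ b ∈ Metric.ball y ε,
      dist (ψ a) (ψ b) = dist a b) :
    ∀ a b : Y, dist (ψ a) (ψ b) = dist a b := by
  intro a b
  choose mid hl hr _ using hY
  obtain ⟨k, hk, hiso⟩ := exists_dyadicChain_isometric_on_triples hloc hl hr a b
  have hk2 : 2 ≤ 2 ^ k := by simpa using Nat.pow_le_pow_right (n := 2) (by norm_num) hk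
  have hN : ((2 ^ k : ℕ) : ℝ) * (dist a b / 2 ^ k) = dist a b := by push_cast; field_simp
  have h₁ : ∀ i, i + 1 ≤ 2 ^ k → dist (ψ (dyadicChain mid a b k i))
      (ψ (dyadicChain mid a b k (i + 1))) = dist a b / 2 ^ k := by
    intro i hi
    have h : dist (ψ (dyadicChain mid a b k i)) (ψ (dyadicChain mid a b k (i + 1))) =
        dist (dyadicChain mid a b k i) (dyadicChain mid a b k (i + 1)) := by
      by_cases h2 : i + 2 ≤ 2 ^ k
      · exact hiso i h2 0 (by norm_num) 1 (by norm_num)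
      · obtain ⟨j, rfl⟩ : ∃ j, i = j + 1 := ⟨i - 1, by omega⟩
        exact hiso j (by omega) 1 (by norm_num) 2 (by norm_num)
    rw [h, dist_dyadicChain_eq hl hr k (Nat.le_succ i) hi]
    push_cast
    ring
  have h₂ : ∀ i, i + 2 ≤ 2 ^ k → dist (ψ (dyadicChain mid a b k i))
      (ψ (dyadicChain mid a b k (i + 2))) = 2 * (dist a b / 2 ^ k) := by
    intro i hi
    have h := hiso i hi 0 (by norm_num) 2 le_rfl
    rw [add_zero] at h
    rw [h, dist_dyadicChain_eq hl hr k (Nat.le_add_right i 2) hi]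
    push_cast
    ring
  have hge := hX.mul_le_dist_of_locally_straight
    (x := fun i => ψ (dyadicChain mid a b k i)) hk2 h₁ h₂
  have hle := dist_le_range_sum_of_dist_le (f := fun i => ψ (dyadicChain mid a b k i)) (2 ^ k)
    (d := fun _ => dist a b / 2 ^ k) (fun hi => (h₁ _ hi).le)
  rw [Finset.sum_const, Finset.card_range, nsmul_eq_mul, hN] at hle
  rw [hN] at hge
  simp only [dyadicChain_zero_right, dyadicChain_two_pow] at hle hge
  exact le_antisymm hle hge
end

section
/- Let X be a complete metric space satisfying the NPC inequality, let L ≥ 0, and let γ : [0,L] → X be a local geodesic, meaning that for every t ∈ [0,L] there exists ε > 0 such that dist(γ(s), γ(s′)) = |s − s′| for all s, s′ ∈ [0,L] with |s − t| < ε and |s′ − t| < ε. Then γ is a geodesic: dist(γ(s), γ(s′)) = |s − s′| for all s, s′ ∈ [0,L]. -/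
/-- `γ` is a local geodesic on `[0, L]`. -/
def IsLocalGeodesicOn {X : Type*} [MetricSpace X] (γ : ℝ → X) (L : ℝ) : Prop :=
  ∀ t ∈ Set.Icc (0 : ℝ) L, ∃ ε > (0 : ℝ),
    ∀ s ∈ Set.Icc (0 : ℝ) L, ∀ s' ∈ Set.Icc (0 : ℝ) L,
      |s - t| < ε → |s' - t| < ε → dist (γ s) (γ s') = |s - s'|

namespace IsLocalGeodesicOn

variable {X : Type*} [MetricSpace X] {γ : ℝ → X} {L : ℝ}

theorem continuousOn (h : IsLocalGeodesicOn γ L) : ContinuousOn γ (Set.Icc 0 L) := by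
  intro t ht
  obtain ⟨ε, hε, hγ⟩ := h t ht
  rw [Metric.continuousWithinAt_iff]
  intro r hr
  refine ⟨min ε r, lt_min hε hr, fun {u} hu hd => ?_⟩
  rw [Real.dist_eq, lt_min_iff] at hd
  rw [hγ u hu t ht hd.1 (by simpa using hε)]
  exact hd.2

theorem dist_le (h : IsLocalGeodesicOn γ L) {a : ℝ} (ha : 0 ≤ a) :
    ∀ t ∈ Set.Icc a L, dist (γ a) (γ t) ≤ t - a := by
  have hcont : ContinuousOn γ (Set.Icc a L) :=
    h.continuousOn.mono (Set.Icc_subset_Icc_left ha)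
  have hclosed : IsClosed ({t | dist (γ a) (γ t) ≤ t - a} ∩ Set.Icc a L) := by
    rw [Set.inter_comm]
    exact isClosed_Icc.isClosed_le (continuous_dist.comp_continuousOn (continuousOn_const.prodMk hcont))
      (continuousOn_id.sub continuousOn_const)
  refine hclosed.Icc_subset_of_forall_exists_gt (by simp) ?_
  rintro T ⟨hT, haT, hTL⟩ y hy
  rw [Set.mem_Ioi] at hy
  rw [Set.mem_ofPred_eq] at hT
  obtain ⟨ε, hε, hγ⟩ := h T ⟨ha.trans haT, hTL.le⟩
  obtain ⟨δ, hδ, hδm⟩ : ∃ δ > 0, δ < min ε (min (y - T) (L - T)) :=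
    exists_between (lt_min hε (lt_min (sub_pos.2 hy) (sub_pos.2 hTL)))
  simp only [lt_min_iff] at hδm
  have hd : dist (γ T) (γ (T + δ)) = δ := by
    rw [hγ T ⟨by linarith, hTL.le⟩ (T + δ) ⟨by linarith, by linarith⟩ (by simpa using hε)
      (by rw [add_sub_cancel_left, abs_of_pos hδ]; exact hδm.1),
      sub_add_cancel_left, abs_neg, abs_of_pos hδ]
  refine ⟨T + δ, ?_, by linarith, by linarith⟩
  rw [Set.mem_ofPred_eq]
  linarith [dist_triangle (γ a) (γ T) (γ (T + δ))]

theorem le_dist (hX : NPC X) (h : IsLocalGeodesicOn γ L) {a : ℝ} (ha : 0 ≤ a) :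
    ∀ t ∈ Set.Icc a L, t - a ≤ dist (γ a) (γ t) := by
  have hcont : ContinuousOn γ (Set.Icc a L) :=
    h.continuousOn.mono (Set.Icc_subset_Icc_left ha)
  have hclosed : IsClosed ({t | t - a ≤ dist (γ a) (γ t)} ∩ Set.Icc a L) := by
    rw [Set.inter_comm]
    exact isClosed_Icc.isClosed_le (continuousOn_id.sub continuousOn_const)
      (continuous_dist.comp_continuousOn (continuousOn_const.prodMk hcont))
  refine hclosed.Icc_subset_of_forall_exists_gt (by simp) ?_
  rintro T ⟨hT, haT, hTL⟩ y hy
  rw [Set.mem_Ioi] at hy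
  rw [Set.mem_ofPred_eq] at hT
  obtain ⟨ε, hε, hγ⟩ := h T ⟨ha.trans haT, hTL.le⟩
  have hloc : ∀ u ∈ Set.Icc a L, ∀ v ∈ Set.Icc a L, |u - T| < ε → |v - T| < ε → u ≤ v →
      dist (γ u) (γ v) = v - u := by
    intro u hu v hv hu' hv' huv
    rw [hγ u ⟨ha.trans hu.1, hu.2⟩ v ⟨ha.trans hv.1, hv.2⟩ hu' hv', abs_sub_comm,
      abs_of_nonneg (sub_nonneg.2 huv)]
  have hT0 : |T - T| < ε := by simpa using hε
  rcases haT.eq_or_lt with rfl | haT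
  · obtain ⟨δ, hδ, hδm⟩ : ∃ δ > 0, δ < min ε (min (y - a) (L - a)) :=
      exists_between (lt_min hε (lt_min (sub_pos.2 hy) (sub_pos.2 hTL)))
    simp only [lt_min_iff] at hδm
    refine ⟨a + δ, ?_, by linarith, by linarith⟩
    exact (hloc a ⟨le_rfl, hTL.le⟩ (a + δ) ⟨by linarith, by linarith⟩ hT0
      (by rw [add_sub_cancel_left, abs_of_pos hδ]; exact hδm.1) (by linarith)).ge
  · obtain ⟨δ, hδ, hδm⟩ : ∃ δ > 0, δ < min (min ε (T - a)) (min (y - T) (L - T)) :=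
      exists_between (lt_min (lt_min hε (sub_pos.2 haT))
        (lt_min (sub_pos.2 hy) (sub_pos.2 hTL)))
    simp only [lt_min_iff] at hδm
    obtain ⟨⟨hδε, hδa⟩, hδy, hδL⟩ := hδm
    have hp : |T + δ - T| < ε := by rwa [add_sub_cancel_left, abs_of_pos hδ]
    have hm : |T - δ - T| < ε := by rwa [sub_sub_cancel_left, abs_neg, abs_of_pos hδ]
    have hTm : T ∈ Set.Icc a L := ⟨haT.le, hTL.le⟩
    have hpm : T + δ ∈ Set.Icc a L := ⟨by linarith, by linarith⟩
    have hmm : T - δ ∈ Set.Icc a L := ⟨by linarith, by linarith⟩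
    have h₁ := hloc (T - δ) hmm T hTm hm hT0 (by linarith)
    have h₂ := hloc T hTm (T + δ) hpm hT0 hp (by linarith)
    have h₃ := hloc (T - δ) hmm (T + δ) hpm hm hp (by linarith)
    have key := hX.dist_sq_midpoint_le (x := γ (T - δ)) (y := γ (T + δ)) (p := γ T)
      (by rw [h₁, h₃]; ring) (by rw [dist_comm, h₂, h₃]; ring) (γ a)
    rw [h₃] at key
    have hle : dist (γ a) (γ (T - δ)) ^ 2 ≤ (T - δ - a) ^ 2 :=
      pow_le_pow_left₀ dist_nonneg (h.dist_le ha _ hmm) 2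
    have hge : (T - a) ^ 2 ≤ dist (γ a) (γ T) ^ 2 :=
      pow_le_pow_left₀ (by linarith) hT 2
    refine ⟨T + δ, ?_, by linarith, by linarith⟩
    exact (pow_le_pow_iff_left₀ (by linarith) dist_nonneg two_ne_zero).1 (by nlinarith)

theorem dist_eq (hX : NPC X) (h : IsLocalGeodesicOn γ L) {s t : ℝ} (hs : 0 ≤ s)
    (hst : s ≤ t) (ht : t ≤ L) : dist (γ s) (γ t) = t - s :=
  (h.dist_le hs t ⟨hst, ht⟩).antisymm (h.le_dist hX hs t ⟨hst, ht⟩)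

end IsLocalGeodesicOn

/-- In a complete NPC space, a local geodesic `γ : [0,L] → X` is a geodesic. -/
theorem npc_local_geodesic_is_geodesic
    (X : Type*) [MetricSpace X] [CompleteSpace X] (hX : NPC X)
    (L : ℝ) (hL : 0 ≤ L) (γ : ℝ → X)
    (hloc : ∀ t ∈ Set.Icc (0 : ℝ) L, ∃ ε > (0 : ℝ),
      ∀ s ∈ Set.Icc (0 : ℝ) L, ∀ s' ∈ Set.Icc (0 : ℝ) L,
        |s - t| < ε → |s' - t| < ε → dist (γ s) (γ s') = |s - s'|) :
    ∀ s ∈ Set.Icc (0 : ℝ) L, ∀ s' ∈ Set.Icc (0 : ℝ) L,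
      dist (γ s) (γ s') = |s - s'| := by
  have h : IsLocalGeodesicOn γ L := hloc
  intro s hs s' hs'
  rcases le_total s s' with hle | hle
  · rw [h.dist_eq hX hs.1 hle hs'.2, abs_sub_comm, abs_of_nonneg (sub_nonneg.2 hle)]
  · rw [dist_comm, h.dist_eq hX hs'.1 hle hs.2, abs_of_nonneg (sub_nonneg.2 hle)]
end
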